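/- Let (X,ω) be a left Frobenius pair in an abelian category C. Then for any C' ∈ X^∧ and any n ≥ 0, the following conditions are equivalent: (a) resdim_X(C') ≤ n; (b) for every exact sequence 0 → K → X_{n−1} → ⋯ → X_1 → X_0 → C' → 0 with all X_i ∈ X, one has K ∈ X. -/

import Mathlib

/-!
Common definitions for Auslander–Buchweitz approximation theory in abelian
categories, following Becerril–Mendoza–Pérez–Santiago.
-/

open CategoryTheory CategoryTheory.Limits ZeroObject

universe w v u

namespace ABFormal

variable {C : Type u} [Category.{v} C] [Abelian C] [CategoryTheory.HasExt.{w} C]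

/-- `0 → A → B → C' → 0` is a short exact sequence in `C`. -/
def IsShortExactSeq {A B C' : C} (f : A ⟶ B) (g : B ⟶ C') : Prop :=
  ∃ w : f ≫ g = 0, (ShortComplex.mk f g w).ShortExact

/-- `ωω` is `XX`-injective: `Ext^i(X, W) = 0` for all `X ∈ XX`, `W ∈ ωω` and `i > 0`. -/
def IsRelInjective (XX ωω : Set C) : Prop :=
  ∀ W ∈ ωω, ∀ X ∈ XX, ∀ i : ℕ, 0 < i → Subsingleton (Abelian.Ext.{w} X W i)

/-- `ωω` is `XX`-projective: `Ext^i(W, X) = 0` for all `X ∈ XX`, `W ∈ ωω` and `i > 0`. -/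
def IsRelProjective (XX ωω : Set C) : Prop :=
  ∀ W ∈ ωω, ∀ X ∈ XX, ∀ i : ℕ, 0 < i → Subsingleton (Abelian.Ext.{w} W X i)

/-- `ωω` is a relative cogenerator in `XX`. -/
def IsRelCogenerator (XX ωω : Set C) : Prop :=
  ωω ⊆ XX ∧ ∀ X ∈ XX, ∃ (W X' : C) (i : X ⟶ W) (p : W ⟶ X'),
    W ∈ ωω ∧ X' ∈ XX ∧ IsShortExactSeq i p

/-- `ωω` is a relative generator in `XX`. -/
def IsRelGenerator (XX ωω : Set C) : Prop :=
  ωω ⊆ XX ∧ ∀ X ∈ XX, ∃ (X' W : C) (i : X' ⟶ W) (p : W ⟶ X),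
    W ∈ ωω ∧ X' ∈ XX ∧ IsShortExactSeq i p

/-- `id_XX(M) ≤ n` : `Ext^j(X, M) = 0` for all `X ∈ XX` and `j > n`. -/
def relInjDimLE (XX : Set C) (M : C) (n : ℕ) : Prop :=
  ∀ X ∈ XX, ∀ j : ℕ, n < j → Subsingleton (Abelian.Ext.{w} X M j)

/-- The relative injective dimension `id_XX(M) : ℕ∞`. -/
noncomputable def relInjDim (XX : Set C) (M : C) : ℕ∞ :=
  sInf {m : ℕ∞ | ∃ n : ℕ, m = (n : ℕ∞) ∧ relInjDimLE XX M n}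

/-- `pd_XX(M) ≤ n` : `Ext^j(M, X) = 0` for all `X ∈ XX` and `j > n`. -/
def relProjDimLE (XX : Set C) (M : C) (n : ℕ) : Prop :=
  ∀ X ∈ XX, ∀ j : ℕ, n < j → Subsingleton (Abelian.Ext.{w} M X j)

/-- The relative projective dimension `pd_XX(M) : ℕ∞`. -/
noncomputable def relProjDim (XX : Set C) (M : C) : ℕ∞ :=
  sInf {m : ℕ∞ | ∃ n : ℕ, m = (n : ℕ∞) ∧ relProjDimLE XX M n}

/-- There is an exact sequence `0 → X_n → ⋯ → X_0 → M → 0` with all `X_i ∈ XX`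
(a resolution of length `n`). -/
inductive HasResolutionLength (XX : Set C) : ℕ → C → Prop
  | zero {M X : C} (hX : X ∈ XX) (e : X ≅ M) : HasResolutionLength XX 0 M
  | succ {n : ℕ} {M : C} (K X : C) (hX : X ∈ XX)
      (i : K ⟶ X) (p : X ⟶ M) (hse : IsShortExactSeq i p)
      (hK : HasResolutionLength XX n K) : HasResolutionLength XX (n + 1) M

/-- The `XX`-resolution dimension `resdim_XX(M) : ℕ∞`. -/
noncomputable def resDim (XX : Set C) (M : C) : ℕ∞ :=
  sInf {m : ℕ∞ | ∃ n : ℕ, m = (n : ℕ∞) ∧ HasResolutionLength XX n M}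

/-- `XX^∧`, the class of objects with a finite `XX`-resolution. -/
def resHat (XX : Set C) : Set C :=
  {M | ∃ n : ℕ, HasResolutionLength XX n M}

/-- There is an exact sequence `0 → M → X^0 → ⋯ → X^n → 0` with all `X^i ∈ XX`
(a coresolution of length `n`). -/
inductive HasCoresolutionLength (XX : Set C) : ℕ → C → Prop
  | zero {M X : C} (hX : X ∈ XX) (e : M ≅ X) : HasCoresolutionLength XX 0 M
  | succ {n : ℕ} {M : C} (X Q : C) (hX : X ∈ XX)
      (i : M ⟶ X) (p : X ⟶ Q) (hse : IsShortExactSeq i p)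
      (hQ : HasCoresolutionLength XX n Q) : HasCoresolutionLength XX (n + 1) M

/-- The `XX`-coresolution dimension `coresdim_XX(M) : ℕ∞`. -/
noncomputable def coresDim (XX : Set C) (M : C) : ℕ∞ :=
  sInf {m : ℕ∞ | ∃ n : ℕ, m = (n : ℕ∞) ∧ HasCoresolutionLength XX n M}

/-- `XX^∨`, the class of objects with a finite `XX`-coresolution. -/
def coresVee (XX : Set C) : Set C :=
  {M | ∃ n : ℕ, HasCoresolutionLength XX n M}

/-- `IsSyzygyOf XX n M K` : there is an exact sequence
`0 → K → X_{n-1} → ⋯ → X_0 → M → 0` with all `X_i ∈ XX`. -/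
inductive IsSyzygyOf (XX : Set C) : ℕ → C → C → Prop
  | zero {M K : C} (e : K ≅ M) : IsSyzygyOf XX 0 M K
  | succ {n : ℕ} {M : C} (K X L : C) (hX : X ∈ XX)
      (i : K ⟶ X) (p : X ⟶ L) (hse : IsShortExactSeq i p)
      (hL : IsSyzygyOf XX n M L) : IsSyzygyOf XX (n + 1) M K

/-- `XX^⊥ = {N | Ext^i(X, N) = 0 for all X ∈ XX, i > 0}`. -/
def rightPerp (XX : Set C) : Set C :=
  {N | ∀ X ∈ XX, ∀ i : ℕ, 0 < i → Subsingleton (Abelian.Ext.{w} X N i)}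

/-- `XX^{⊥₁} = {N | Ext^1(X, N) = 0 for all X ∈ XX}`. -/
def rightPerp1 (XX : Set C) : Set C :=
  {N | ∀ X ∈ XX, Subsingleton (Abelian.Ext.{w} X N 1)}

/-- `^⊥XX = {N | Ext^i(N, X) = 0 for all X ∈ XX, i > 0}`. -/
def leftPerp (XX : Set C) : Set C :=
  {N | ∀ X ∈ XX, ∀ i : ℕ, 0 < i → Subsingleton (Abelian.Ext.{w} N X i)}

/-- `^{⊥₁}XX = {N | Ext^1(N, X) = 0 for all X ∈ XX}`. -/
def leftPerp1 (XX : Set C) : Set C :=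
  {N | ∀ X ∈ XX, Subsingleton (Abelian.Ext.{w} N X 1)}

/-- Closed under extensions. -/
def ClosedUnderExtensions (XX : Set C) : Prop :=
  ∀ ⦃A B C' : C⦄ (f : A ⟶ B) (g : B ⟶ C'), IsShortExactSeq f g →
    A ∈ XX → C' ∈ XX → B ∈ XX

/-- Closed under kernels of epimorphisms between objects of the class. -/
def ClosedUnderKernelsOfEpis (XX : Set C) : Prop :=
  ∀ ⦃A B C' : C⦄ (f : A ⟶ B) (g : B ⟶ C'), IsShortExactSeq f g →
    B ∈ XX → C' ∈ XX → A ∈ XX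

/-- Closed under cokernels of monomorphisms between objects of the class. -/
def ClosedUnderCokernelsOfMonos (XX : Set C) : Prop :=
  ∀ ⦃A B C' : C⦄ (f : A ⟶ B) (g : B ⟶ C'), IsShortExactSeq f g →
    A ∈ XX → B ∈ XX → C' ∈ XX

/-- Closed under direct summands (retracts) in `C`. -/
def ClosedUnderSummands (XX : Set C) : Prop :=
  ∀ ⦃X A : C⦄, X ∈ XX → ∀ (s : A ⟶ X) (r : X ⟶ A), s ≫ r = 𝟙 A → A ∈ XX

/-- Pre-resolving class: closed under extensions and kernels of epimorphisms. -/
def IsPreresolving (XX : Set C) : Prop :=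
  ClosedUnderExtensions XX ∧ ClosedUnderKernelsOfEpis XX

/-- Pre-coresolving class: closed under extensions and cokernels of monomorphisms. -/
def IsPrecoresolving (XX : Set C) : Prop :=
  ClosedUnderExtensions XX ∧ ClosedUnderCokernelsOfMonos XX

/-- Left thick class. -/
def IsLeftThick (XX : Set C) : Prop :=
  IsPreresolving XX ∧ ClosedUnderSummands XX

/-- Right thick class. -/
def IsRightThick (XX : Set C) : Prop :=
  IsPrecoresolving XX ∧ ClosedUnderSummands XX

/-- Thick class. -/
def IsThickClass (XX : Set C) : Prop :=
  IsLeftThick XX ∧ IsRightThick XX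

/-- The smallest thick class of `C` containing `S`. -/
def thickClosure (S : Set C) : Set C :=
  ⋂₀ {T : Set C | IsThickClass T ∧ S ⊆ T}

/-- The class of projective objects of `C`. -/
def ProjClass (C : Type u) [Category.{v} C] : Set C := {P | Projective P}

/-- The class of injective objects of `C`. -/
def InjClass (C : Type u) [Category.{v} C] : Set C := {I | Injective I}

/-- Resolving class in `C`: pre-resolving and containing all projectives. -/
def IsResolvingClass (XX : Set C) : Prop :=
  IsPreresolving XX ∧ ProjClass C ⊆ XX

/-- Coresolving class in `C`: pre-coresolving and containing all injectives. -/
def IsCoresolvingClass (XX : Set C) : Prop :=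
  IsPrecoresolving XX ∧ InjClass C ⊆ XX

/-- A left Frobenius pair `(XX, ωω)` in `C`. -/
structure LeftFrobeniusPair (XX ωω : Set C) : Prop where
  leftThick : IsLeftThick XX
  relInj : IsRelInjective XX ωω
  relCogen : IsRelCogenerator XX ωω
  summands : ClosedUnderSummands ωω

/-- A strong left Frobenius pair `(XX, ωω)` in `C`. -/
structure StrongLeftFrobeniusPair (XX ωω : Set C) extends LeftFrobeniusPair XX ωω : Prop where
  relProj : IsRelProjective XX ωω
  relGen : IsRelGenerator XX ωω

/-- A right Frobenius pair `(νν, YY)` in `C`. -/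
structure RightFrobeniusPair (νν YY : Set C) : Prop where
  rightThick : IsRightThick YY
  relProj : IsRelProjective YY νν
  relGen : IsRelGenerator YY νν
  summands : ClosedUnderSummands νν

/-- `φ : X ⟶ M` is an `XX`-precover of `M`. -/
def IsPrecover (XX : Set C) {X M : C} (φ : X ⟶ M) : Prop :=
  X ∈ XX ∧ ∀ (X' : C), X' ∈ XX → ∀ f : X' ⟶ M, ∃ h : X' ⟶ X, h ≫ φ = f

/-- `φ : M ⟶ Y` is an `XX`-preenvelope of `M`. -/
def IsPreenvelope (XX : Set C) {M Y : C} (φ : M ⟶ Y) : Prop :=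
  Y ∈ XX ∧ ∀ (Y' : C), Y' ∈ XX → ∀ f : M ⟶ Y', ∃ h : Y ⟶ Y', φ ≫ h = f

/-- A left `S`-cotorsion pair `(F, G)` in `C`. -/
def IsLeftCotorsionPair (S F G : Set C) : Prop :=
  F ⊆ S ∧ G ⊆ S ∧
  F = {A | A ∈ S ∧ ∀ G' ∈ G, Subsingleton (Abelian.Ext.{w} A G' 1)} ∧
  ∀ s ∈ S, ∃ (G' F' : C) (i : G' ⟶ F') (p : F' ⟶ s),
    G' ∈ G ∧ F' ∈ F ∧ IsShortExactSeq i p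

/-- A right `S`-cotorsion pair `(F, G)` in `C`. -/
def IsRightCotorsionPair (S F G : Set C) : Prop :=
  F ⊆ S ∧ G ⊆ S ∧
  G = {A | A ∈ S ∧ ∀ F' ∈ F, Subsingleton (Abelian.Ext.{w} F' A 1)} ∧
  ∀ s ∈ S, ∃ (G' F' : C) (i : s ⟶ G') (p : G' ⟶ F'),
    G' ∈ G ∧ F' ∈ F ∧ IsShortExactSeq i p

/-- An `S`-cotorsion pair `(F, G)` in `C`. -/
def IsCotorsionPair (S F G : Set C) : Prop :=
  IsLeftCotorsionPair S F G ∧ IsRightCotorsionPair S F G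

/-- A left weak AB context `(AA, BB)` in `C`. -/
structure LeftWeakABContext (AA BB : Set C) : Prop where
  frob : LeftFrobeniusPair AA (AA ∩ BB)
  rightThick : IsRightThick BB
  sub : BB ⊆ resHat AA

section

omit [HasExt.{w} C]

namespace IsShortExactSeq

variable {A B D E : C} {f : A ⟶ B} {g : B ⟶ D}

lemma mono (h : IsShortExactSeq f g) : Mono f := h.choose_spec.mono_f

lemma epi (h : IsShortExactSeq f g) : Epi g := h.choose_spec.epi_g

lemma comp_eq_zero (h : IsShortExactSeq f g) : f ≫ g = 0 := h.choose

lemma exists_lift (h : IsShortExactSeq f g) {T : C} (x : T ⟶ B) (hx : x ≫ g = 0) :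
    ∃ y : T ⟶ A, y ≫ f = x := by
  obtain ⟨w, hS⟩ := h
  have := hS.mono_f
  exact ⟨hS.exact.lift x hx, hS.exact.lift_f x hx⟩

lemma exists_desc (h : IsShortExactSeq f g) {T : C} (x : B ⟶ T) (hx : f ≫ x = 0) :
    ∃ y : D ⟶ T, g ≫ y = x := by
  obtain ⟨w, hS⟩ := h
  have := hS.epi_g
  exact ⟨hS.exact.desc x hx, hS.exact.g_desc x hx⟩

lemma of_lift [Mono f] [Epi g] (w : f ≫ g = 0)
    (h : ∀ {T : C} (x : T ⟶ B), x ≫ g = 0 → ∃ y : T ⟶ A, y ≫ f = x) :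
    IsShortExactSeq f g := by
  refine ⟨w, .mk' ?_ ‹_› ‹_›⟩
  rw [ShortComplex.exact_iff_exact_up_to_refinements]
  intro T x hx
  obtain ⟨y, hy⟩ := h x hx
  exact ⟨T, 𝟙 T, inferInstance, y, by simpa using hy.symm⟩

lemma of_desc [Mono f] [Epi g] (w : f ≫ g = 0)
    (h : ∀ {T : C} (x : B ⟶ T), f ≫ x = 0 → ∃ y : D ⟶ T, g ≫ y = x) :
    IsShortExactSeq f g := by
  refine ⟨w, .mk' ?_ ‹_› ‹_›⟩
  refine ShortComplex.exact_of_g_is_cokernel _ (CokernelCofork.IsColimit.ofπ _ _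
    (fun x hx => (h x hx).choose) (fun x hx => (h x hx).choose_spec) fun x hx m hm => ?_)
  rw [← cancel_epi g]
  exact hm.trans (h x hx).choose_spec.symm

lemma of_iso_zero (e : A ≅ B) : IsShortExactSeq (0 : (0 : C) ⟶ A) e.hom :=
  .of_lift zero_comp fun x hx => ⟨0, by
    rw [zero_comp, ← cancel_mono e.hom, hx, zero_comp]⟩

lemma comp_iso (h : IsShortExactSeq f g) (e : D ≅ E) : IsShortExactSeq f (g ≫ e.hom) := by
  have := h.mono
  have := h.epi
  refine .of_lift (by rw [reassoc_of% h.comp_eq_zero, zero_comp]) fun x hx => ?_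
  refine h.exists_lift x ?_
  rwa [← cancel_mono e.hom, Category.assoc, zero_comp]

lemma iso_comp (h : IsShortExactSeq f g) (e : E ≅ A) : IsShortExactSeq (e.hom ≫ f) g := by
  have := h.mono
  have := h.epi
  refine .of_lift (by rw [Category.assoc, h.comp_eq_zero, comp_zero]) fun x hx => ?_
  obtain ⟨y, hy⟩ := h.exists_lift x hx
  exact ⟨y ≫ e.inv, by simpa using hy⟩

/-- Pushing out a short exact sequence along a morphism out of its left term. -/
lemma pushout (h : IsShortExactSeq f g) (k : A ⟶ E) :
    ∃ q : pushout f k ⟶ D, IsShortExactSeq (pushout.inr f k) q := by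
  have := h.mono
  have := h.epi
  let q : Limits.pushout f k ⟶ D := pushout.desc g 0 (by rw [h.comp_eq_zero, comp_zero])
  have hq : pushout.inl f k ≫ q = g := pushout.inl_desc _ _ _
  have : Epi q := by
    have : Epi (pushout.inl f k ≫ q) := by rwa [hq]
    exact epi_of_epi (pushout.inl f k) q
  refine ⟨q, .of_desc (pushout.inr_desc _ _ _) fun x hx => ?_⟩
  obtain ⟨y, hy⟩ := h.exists_desc (pushout.inl f k ≫ x)
    (by rw [pushout.condition_assoc, hx, comp_zero])
  refine ⟨y, pushout.hom_ext ?_ ?_⟩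
  · rw [reassoc_of% hq, hy]
  · rw [hx, pushout.inr_desc_assoc, zero_comp]

lemma pushout' (h : IsShortExactSeq f g) (k : A ⟶ E) :
    ∃ q : Limits.pushout k f ⟶ D, IsShortExactSeq (pushout.inl k f) q := by
  obtain ⟨q, hq⟩ := h.pushout k
  refine ⟨(pushoutSymmetry f k).inv ≫ q, ?_⟩
  have := hq.mono
  have := hq.epi
  have := h.mono
  refine .of_lift (by simpa using hq.comp_eq_zero) fun x hx => ?_
  obtain ⟨y, hy⟩ := hq.exists_lift (x ≫ (pushoutSymmetry f k).inv) (by simpa using hx)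
  refine ⟨y, ?_⟩
  rw [← cancel_mono (pushoutSymmetry f k).inv, ← hy]
  simp

/-- Pushing out an epimorphism with known kernel along a monomorphism. -/
lemma pushout_of_mono (h : IsShortExactSeq f g) (k : B ⟶ E) [Mono k] :
    IsShortExactSeq (f ≫ k) (pushout.inr g k) := by
  have := h.mono
  have := h.epi
  refine .of_desc ?_ fun x hx => ?_
  · rw [Category.assoc, ← pushout.condition, reassoc_of% h.comp_eq_zero, zero_comp]
  · obtain ⟨y, hy⟩ := h.exists_desc (k ≫ x) (by simpa using hx)
    exact ⟨pushout.desc y x hy, pushout.inr_desc _ _ _⟩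

/-- Pulling back a short exact sequence along a morphism into its right term. -/
lemma pullback (h : IsShortExactSeq f g) (k : E ⟶ D) :
    ∃ i : A ⟶ pullback g k, IsShortExactSeq i (pullback.snd g k) := by
  have := h.mono
  have := h.epi
  let i : A ⟶ Limits.pullback g k := pullback.lift f 0 (by rw [h.comp_eq_zero, zero_comp])
  have hi : i ≫ pullback.fst g k = f := pullback.lift_fst _ _ _
  have : Mono i := by
    have : Mono (i ≫ pullback.fst g k) := by rwa [hi]
    exact mono_of_mono i (pullback.fst g k)
  refine ⟨i, .of_lift (pullback.lift_snd _ _ _) fun x hx => ?_⟩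
  obtain ⟨y, hy⟩ := h.exists_lift (x ≫ pullback.fst g k)
    (by rw [Category.assoc, pullback.condition, reassoc_of% hx, zero_comp])
  refine ⟨y, pullback.hom_ext ?_ ?_⟩
  · rw [Category.assoc, hi, hy]
  · rw [hx, Category.assoc, pullback.lift_snd, comp_zero]

lemma pullback' (h : IsShortExactSeq f g) (k : E ⟶ D) :
    ∃ i : A ⟶ Limits.pullback k g, IsShortExactSeq i (pullback.fst k g) := by
  obtain ⟨i, hi⟩ := h.pullback k
  refine ⟨i ≫ (pullbackSymmetry g k).hom, ?_⟩
  have := hi.mono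
  have := hi.epi
  have := h.epi
  refine .of_lift (by simpa using hi.comp_eq_zero) fun x hx => ?_
  obtain ⟨y, hy⟩ := hi.exists_lift (x ≫ (pullbackSymmetry g k).inv) (by simpa using hx)
  exact ⟨y, by rw [reassoc_of% hy]; simp⟩

/-- Pulling back a monomorphism with known cokernel along an epimorphism. -/
lemma pullback_of_epi (h : IsShortExactSeq f g) (k : E ⟶ B) [Epi k] :
    IsShortExactSeq (pullback.snd f k) (k ≫ g) := by
  have := h.mono
  have := h.epi
  refine .of_lift ?_ fun x hx => ?_
  · rw [← Category.assoc, ← pullback.condition, Category.assoc, h.comp_eq_zero, comp_zero]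
  · obtain ⟨y, hy⟩ := h.exists_lift (x ≫ k) (by simpa using hx)
    exact ⟨pullback.lift y x hy, pullback.lift_snd _ _ _⟩

lemma exists_section [HasExt.{w} C] (h : IsShortExactSeq f g)
    (hExt : Subsingleton (Abelian.Ext.{w} D A 1)) : ∃ s : D ⟶ B, s ≫ g = 𝟙 D := by
  obtain ⟨w, hS⟩ := h
  obtain ⟨s, hs⟩ := Abelian.Ext.covariant_sequence_exact₃ D hS (Abelian.Ext.mk₀ (𝟙 D))
    (zero_add 1) (Subsingleton.elim _ _)
  obtain ⟨s, rfl⟩ := Abelian.Ext.addEquiv₀.symm.surjective s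
  refine ⟨s, Abelian.Ext.addEquiv₀.symm.injective ?_⟩
  simpa using hs

/-- If `p : E ⟶ A` is an epimorphism with kernel `K` and `s` is a section of `g`, then
`E ⊞ D ⟶ B` is an epimorphism with kernel `K`. -/
lemma biprod_desc (h : IsShortExactSeq f g) {s : D ⟶ B} (hs : s ≫ g = 𝟙 D) {K : C}
    {i : K ⟶ E} {p : E ⟶ A} (hp : IsShortExactSeq i p) :
    IsShortExactSeq (i ≫ biprod.inl) (biprod.desc (p ≫ f) s) := by
  have := h.mono
  have := hp.mono
  have := hp.epi
  have : Epi (biprod.desc (p ≫ f) s) := by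
    refine Preadditive.epi_of_cancel_zero _ fun {T} x hx => ?_
    have h₁ : f ≫ x = 0 := by
      rw [← cancel_epi p, comp_zero, ← Category.assoc]
      simpa using biprod.inl ≫= hx
    have h₂ : s ≫ x = 0 := by simpa using biprod.inr ≫= hx
    obtain ⟨y, rfl⟩ := h.exists_desc x h₁
    rw [reassoc_of% hs] at h₂
    rw [h₂, comp_zero]
  refine .of_lift (by simp [reassoc_of% hp.comp_eq_zero]) fun {T} x hx => ?_
  have hx' : x = (x ≫ biprod.fst) ≫ biprod.inl + (x ≫ biprod.snd) ≫ biprod.inr := by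
    ext <;> simp
  have h₂ : x ≫ biprod.snd = 0 := by
    have := hx =≫ g
    rw [hx'] at this
    simpa [hs, h.comp_eq_zero] using this
  rw [h₂, zero_comp, add_zero] at hx'
  obtain ⟨y, hy⟩ := hp.exists_lift (x ≫ biprod.fst) (by
    rw [← cancel_mono f, zero_comp, Category.assoc]
    rw [hx'] at hx
    simpa using hx)
  exact ⟨y, by rw [hx', ← hy, Category.assoc]⟩

end IsShortExactSeq

omit [Abelian C] in
lemma ClosedUnderSummands.mem_of_iso {XX : Set C} (h : ClosedUnderSummands XX) {A B : C}
    (e : A ≅ B) (hA : A ∈ XX) : B ∈ XX :=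
  h hA e.inv e.hom e.inv_hom_id

lemma ClosedUnderExtensions.biprod_mem {XX : Set C} (h : ClosedUnderExtensions XX) {A B : C}
    (hA : A ∈ XX) (hB : B ∈ XX) : (A ⊞ B : C) ∈ XX :=
  h (biprod.inl : A ⟶ A ⊞ B) biprod.snd
    (.of_lift (by simp) fun x hx => ⟨x ≫ biprod.fst, by ext <;> simp [hx]⟩) hA hB

lemma HasResolutionLength.of_iso {XX : Set C} {n : ℕ} {A B : C}
    (h : HasResolutionLength XX n A) (e : A ≅ B) : HasResolutionLength XX n B := by
  cases h with
  | zero hX e' => exact .zero hX (e' ≪≫ e)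
  | succ K X hX i p hse hK => exact .succ K X hX i (p ≫ e.hom) (hse.comp_iso e) hK

lemma HasResolutionLength.mem {XX : Set C} (hXX : ClosedUnderSummands XX) {M : C}
    (h : HasResolutionLength XX 0 M) : M ∈ XX := by
  cases h with
  | zero hX e => exact hXX.mem_of_iso e hX

lemma HasResolutionLength.mono {XX YY : Set C} (hXY : XX ⊆ YY) {n : ℕ} {M : C}
    (h : HasResolutionLength XX n M) : HasResolutionLength YY n M := by
  induction h with
  | zero hX e => exact .zero (hXY hX) e
  | succ K X hX i p hse _ ih => exact .succ K X (hXY hX) i p hse ih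

lemma HasResolutionLength.of_isSyzygyOf {XX : Set C} {n k : ℕ} {M K : C}
    (h : IsSyzygyOf XX n M K) (hK : HasResolutionLength XX k K) :
    HasResolutionLength XX (n + k) M := by
  induction h generalizing k with
  | zero e => simpa using hK.of_iso e
  | @succ n M K X L hX i p hse _ ih =>
    rw [add_right_comm, add_assoc]
    exact ih (.succ K X hX i p hse hK)

lemma IsSyzygyOf.succ_left {XX : Set C} {n : ℕ} {L X M K : C} (hX : X ∈ XX) {i : L ⟶ X}
    {p : X ⟶ M} (hse : IsShortExactSeq i p) (h : IsSyzygyOf XX n L K) :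
    IsSyzygyOf XX (n + 1) M K := by
  induction h with
  | zero e => exact .succ _ _ _ hX _ _ (hse.iso_comp e) (.zero (Iso.refl _))
  | succ K' X' L' hX' i' p' hse' _ ih => exact .succ _ _ _ hX' _ _ hse' (ih hse)

lemma HasResolutionLength.exists_isSyzygyOf {XX : Set C} {m : ℕ} {M : C}
    (h : HasResolutionLength XX m M) {n : ℕ} (hn : n ≤ m) : ∃ K, IsSyzygyOf XX n M K := by
  induction h generalizing n with
  | zero hX e =>
    obtain rfl : n = 0 := by lia
    exact ⟨_, .zero (Iso.refl _)⟩
  | succ L X hX i p hse _ ih =>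
    cases n with
    | zero => exact ⟨_, .zero (Iso.refl _)⟩
    | succ n =>
      obtain ⟨K, hK⟩ := ih (Nat.le_of_succ_le_succ hn)
      exact ⟨K, hK.succ_left hX hse⟩

lemma resDim_le_iff {XX : Set C} {M : C} {n : ℕ} :
    resDim XX M ≤ n ↔ ∃ m ≤ n, HasResolutionLength XX m M := by
  constructor
  · intro h
    have hne : {m : ℕ∞ | ∃ n : ℕ, m = (n : ℕ∞) ∧ HasResolutionLength XX n M}.Nonempty := by
      by_contra hne
      rw [Set.not_nonempty_iff_eq_empty] at hne
      rw [resDim, hne, sInf_empty] at h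
      exact absurd h (by simp)
    obtain ⟨m, hm, hM⟩ := csInf_mem hne
    refine ⟨m, ?_, hM⟩
    rw [resDim, hm] at h
    exact_mod_cast h
  · rintro ⟨m, hm, hM⟩
    exact (sInf_le ⟨m, rfl, hM⟩ : resDim XX M ≤ m).trans (by exact_mod_cast hm)

/-- Resolution dimension does not increase on passing to the kernel of an epimorphism onto an
object of the class. -/
lemma HasResolutionLength.of_epi {XX : Set C} (hXX : IsLeftThick XX) {n : ℕ} {A B X : C}
    {f : A ⟶ B} {g : B ⟶ X} (h : IsShortExactSeq f g) (hX : X ∈ XX)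
    (hB : HasResolutionLength XX n B) : HasResolutionLength XX n A := by
  cases hB with
  | zero hB e => exact .zero (hXX.1.2 f g h (hXX.2.mem_of_iso e hB) hX) (Iso.refl _)
  | succ K X₀ hX₀ i p hse hK =>
    have := hse.epi
    obtain ⟨j, hj⟩ := hse.pullback' f
    exact .succ K _ (hXX.1.2 _ _ (h.pullback_of_epi p) hX₀ hX) j _ hj hK

end

/-- Objects with finite `ωω`-resolutions inherit relative injectivity from `ωω`. -/
lemma IsRelInjective.mem_rightPerp {XX ωω : Set C}
    (h : IsRelInjective.{w} XX ωω) {n : ℕ} {Y : C} (hY : HasResolutionLength ωω n Y) :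
    Y ∈ rightPerp.{w} XX := by
  induction hY with
  | zero hW e =>
    intro X hX j hj
    have := h _ hW X hX j hj
    refine ⟨fun a b => ?_⟩
    have key (a : Abelian.Ext.{w} X _ j) :
        (a.comp (Abelian.Ext.mk₀ e.inv) (add_zero j)).comp
          (Abelian.Ext.mk₀ e.hom) (add_zero j) = a := by simp
    rw [← key a, ← key b, Subsingleton.elim (a.comp _ _) (b.comp (Abelian.Ext.mk₀ e.inv) _)]
  | succ K W hW i p hse _ ih =>
    intro X hX j hj
    obtain ⟨w, hS⟩ := hse
    have := h _ hW X hX j hj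
    have := ih X hX (j + 1) j.succ_pos
    refine subsingleton_of_forall_eq 0 fun a => ?_
    obtain ⟨b, rfl⟩ := Abelian.Ext.covariant_sequence_exact₃ X hS a rfl (Subsingleton.elim _ _)
    rw [Subsingleton.elim b 0, Abelian.Ext.zero_comp]

namespace LeftFrobeniusPair

variable {XX ωω : Set C}

/-- An object with an `XX`-resolution of length `n` embeds, with cokernel in `XX`, into an
object with an `ωω`-resolution of length `n`. -/
lemma exists_mono (hfrob : LeftFrobeniusPair.{w} XX ωω) {n : ℕ} {M : C}
    (hM : HasResolutionLength XX n M) :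
    ∃ (Y X : C) (i : M ⟶ Y) (p : Y ⟶ X),
      HasResolutionLength ωω n Y ∧ X ∈ XX ∧ IsShortExactSeq i p := by
  induction hM with
  | zero hX e =>
    obtain ⟨W, X', i, p, hW, hX', h⟩ :=
      hfrob.relCogen.2 _ (hfrob.leftThick.2.mem_of_iso e hX)
    exact ⟨W, X', i, p, .zero hW (Iso.refl _), hX', h⟩
  | succ L X₀ hX₀ i p hse _ ih =>
    obtain ⟨Y, X₂, j, q, hY, hX₂, hj⟩ := ih
    obtain ⟨r, hr⟩ := hj.pushout' i
    obtain ⟨s, hs⟩ := hse.pushout j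
    obtain ⟨W, X₃, a, b, hW, hX₃, ha⟩ :=
      hfrob.relCogen.2 _ (hfrob.leftThick.1.1 _ _ hr hX₀ hX₂)
    have := ha.mono
    obtain ⟨t, ht⟩ := ha.pushout' s
    exact ⟨_, X₃, _, t, .succ Y W hW _ _ (hs.pushout_of_mono a) hY, hX₃, ht⟩

/-- Objects with an `XX`-resolution of length `n` are closed under extensions by objects
of `XX`. -/
lemma hasResolutionLength_of_extension (hfrob : LeftFrobeniusPair.{w} XX ωω) {n : ℕ}
    {A B X : C} {f : A ⟶ B} {g : B ⟶ X} (h : IsShortExactSeq f g)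
    (hA : HasResolutionLength XX n A) (hX : X ∈ XX) : HasResolutionLength XX n B := by
  obtain ⟨Y, X', i, p, hY, hX', hi⟩ := hfrob.exists_mono hA
  obtain ⟨q, hq⟩ := h.pushout i
  obtain ⟨r, hr⟩ := hi.pushout' f
  refine .of_epi hfrob.leftThick hr hX' ?_
  obtain ⟨s, hs⟩ := hq.exists_section (hfrob.relInj.mem_rightPerp hY X hX 1 one_pos)
  cases hY with
  | zero hW e =>
    exact .zero (hfrob.leftThick.1.1 _ _ hq
      (hfrob.leftThick.2.mem_of_iso e (hfrob.relCogen.1 hW)) hX) (Iso.refl _)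
  | succ K W hW j c hse hK =>
    exact .succ K _ (hfrob.leftThick.1.1.biprod_mem (hfrob.relCogen.1 hW) hX) _ _
      (hq.biprod_desc hs hse) (hK.mono hfrob.relCogen.1)

lemma hasResolutionLength_of_isSyzygyOf (hfrob : LeftFrobeniusPair.{w} XX ωω) {m n : ℕ}
    {M K : C} (hM : HasResolutionLength XX m M) (hK : IsSyzygyOf XX n M K) :
    HasResolutionLength XX (m - n) K := by
  induction hK with
  | zero e => exact hM.of_iso e.symm
  | @succ n M K X L hX i p hse _ ih =>
    have hL := ih hM
    rw [← Nat.sub_sub]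
    generalize m - n = k at hL ⊢
    cases hL with
    | zero hL e =>
      exact .zero (hfrob.leftThick.1.2 _ _ hse hX (hfrob.leftThick.2.mem_of_iso e hL))
        (Iso.refl _)
    | succ A X₀ hX₀ j q hj hA =>
      obtain ⟨a, ha⟩ := hj.pullback p
      obtain ⟨b, hb⟩ := hse.pullback' q
      exact .of_epi hfrob.leftThick hb hX₀ (hfrob.hasResolutionLength_of_extension ha hA hX)

end LeftFrobeniusPair

/-- Proposition AB10. Let `(X,ω)` be a left Frobenius pair. For
`C' ∈ X^∧` and `n ≥ 0`: `resdim_X(C') ≤ n` iff for every exact sequence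
`0 → K → X_{n−1} → ⋯ → X_0 → C' → 0` with all `X_i ∈ X`, one has `K ∈ X`. -/
theorem stmt7 (XX ωω : Set C) (hfrob : LeftFrobeniusPair XX ωω)
    (C' : C) (hC' : C' ∈ resHat XX) (n : ℕ) :
    resDim XX C' ≤ (n : ℕ∞) ↔ ∀ K : C, IsSyzygyOf XX n C' K → K ∈ XX := by
  rw [resDim_le_iff]
  constructor
  · rintro ⟨m, hm, hM⟩ K hK
    have h := hfrob.hasResolutionLength_of_isSyzygyOf hM hK
    rw [Nat.sub_eq_zero_of_le hm] at h
    exact h.mem hfrob.leftThick.2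
  · intro h
    obtain ⟨m, hm⟩ := hC'
    obtain hmn | hnm := le_total m n
    · exact ⟨m, hmn, hm⟩
    · obtain ⟨K, hK⟩ := hm.exists_isSyzygyOf hnm
      exact ⟨n, le_rfl, .of_isSyzygyOf hK (.zero (h K hK) (Iso.refl _))⟩

end ABFormal
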